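/- There exists N ∈ ℕ such that for any connected graph G on n ≥ N vertices in which every vertex has degree at least 4, the burning number of G satisfies b(G) ≤ ⌈√n⌉. -/

import Mathlib

open SimpleGraph

/-- A graph is `k`-burnable if there is a sequence of `k` vertices `v 0, …, v (k-1)`
(`v i` being set on fire at step `i+1`) whose closed balls of radii `k-1-i` cover the graph. -/
def Burnable {V : Type*} (G : SimpleGraph V) (k : ℕ) : Prop :=
  ∃ v : Fin k → V, ∀ u : V, ∃ i : Fin k,
    G.Reachable (v i) u ∧ G.dist (v i) u ≤ k - 1 - (i : ℕ)

/-- The burning number of a graph: the least `k` such that `G` is `k`-burnable. -/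
noncomputable def burningNumber {V : Type*} (G : SimpleGraph V) : ℕ :=
  sInf {k | Burnable G k}

/-- `X` is closed under taking parents, for a rooted forest given by a parent map and a depth
function, and `root` is the only element of `X` of depth zero. -/
def ParentClosed {V : Type*} (par : V → V) (dp : V → ℕ) (root : V) (X : Finset V) : Prop :=
  ∀ x ∈ X, (dp x = 0 ∧ x = root) ∨ (par x ∈ X ∧ dp (par x) + 1 = dp x)

/-- `c` and `x` have a common ancestor through which they are joined by a path of length at
most `r`. -/
def Near {V : Type*} (par : V → V) (c x : V) (r : ℕ) : Prop :=
  ∃ i j, par^[i] x = par^[j] c ∧ i + j ≤ r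

/-- A ball of radius `r` covers the complement in `X` of a parent-closed set that is empty or
has at least `g` elements fewer than `X`. -/
def Prunes {V : Type*} (par : V → V) (dp : V → ℕ) (root : V) (X : Finset V) (r g : ℕ) : Prop :=
  ∃ c, ∃ Y : Finset V, ParentClosed par dp root Y ∧ (∀ x ∈ X, x ∉ Y → Near par c x r) ∧
    (Y = ∅ ∨ Y.card + g ≤ X.card)

/-- `X` is covered by balls indexed by `A`, the ball of index `i` having radius `i / 3`. -/
def Coverable {V : Type*} (par : V → V) (X : Finset V) (A : Set ℕ) : Prop :=
  ∃ c : ℕ → V, ∀ x ∈ X, ∃ i ∈ A, Near par (c i) x (i / 3)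

section Forest

variable {V : Type*} {par : V → V} {dp : V → ℕ} {root : V} {X : Finset V}

theorem ParentClosed.iterate (hX : ParentClosed par dp root X) {x : V} (hx : x ∈ X) (j : ℕ)
    (hj : j ≤ dp x) : par^[j] x ∈ X ∧ dp (par^[j] x) + j = dp x := by
  induction j with
  | zero => simpa using hx
  | succ j ih =>
    obtain ⟨h1, h2⟩ := ih (by omega)
    rw [Function.iterate_succ_apply']
    rcases hX _ h1 with h | h
    · omega
    · exact ⟨h.1, by omega⟩

theorem ParentClosed.near_root (hX : ParentClosed par dp root X) {x : V} (hx : x ∈ X) {r : ℕ}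
    (hr : dp x ≤ r) : Near par root x r := by
  obtain ⟨h1, h2⟩ := hX.iterate hx (dp x) le_rfl
  refine ⟨dp x, 0, ?_, by omega⟩
  rcases hX _ h1 with h | h
  · simpa using h.2
  · omega

open Classical in
/-- The elements of `X` that are not descendants of `y`. -/
noncomputable def nonDescendants (par : V → V) (dp : V → ℕ) (X : Finset V) (y : V) : Finset V :=
  X.filter fun x => ∀ j ≤ dp x, par^[j] x ≠ y

theorem ParentClosed.nonDescendants (hX : ParentClosed par dp root X) (y : V) :
    ParentClosed par dp root (nonDescendants par dp X y) := by
  classical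
  intro x hx
  simp only [_root_.nonDescendants, Finset.mem_filter] at hx ⊢
  rcases hX x hx.1 with h | h
  · exact Or.inl h
  · refine Or.inr ⟨⟨h.1, fun j hj => ?_⟩, h.2⟩
    have := hx.2 (j + 1) (by omega)
    rwa [Function.iterate_succ_apply] at this

theorem card_nonDescendants_add_le (y : V) (Z : Finset V) (hZX : Z ⊆ X)
    (hZ : ∀ z ∈ Z, ∃ j ≤ dp z, par^[j] z = y) :
    (nonDescendants par dp X y).card + Z.card ≤ X.card := by
  classical
  rw [← Finset.card_union_of_disjoint]
  · refine Finset.card_le_card (Finset.union_subset (Finset.filter_subset _ _) hZX)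
  · rw [Finset.disjoint_left]
    intro z hz hz'
    obtain ⟨j, hj, h⟩ := hZ z hz'
    exact (Finset.mem_filter.1 hz).2 j hj h

/-- The first `n` elements of the path from `u` towards the root. -/
noncomputable def ancestorPath [DecidableEq V] (par : V → V) (u : V) (n : ℕ) : Finset V :=
  (Finset.range n).image fun j => par^[j] u

theorem ParentClosed.card_ancestorPath [DecidableEq V] (hX : ParentClosed par dp root X) {u : V}
    (hu : u ∈ X) {n : ℕ} (hn : n ≤ dp u + 1) : (ancestorPath par u n).card = n := by
  rw [ancestorPath, Finset.card_image_of_injOn, Finset.card_range]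
  intro i hi j hj hij
  simp only [Finset.coe_range, Set.mem_Iio] at hi hj
  have h1 := (hX.iterate hu i (by omega)).2
  have h2 := (hX.iterate hu j (by omega)).2
  simp only at hij
  rw [hij] at h1
  omega

theorem ParentClosed.ancestorPath_subset [DecidableEq V] (hX : ParentClosed par dp root X) {u : V}
    (hu : u ∈ X) {n : ℕ} (hn : n ≤ dp u + 1) : ancestorPath par u n ⊆ X := by
  intro z hz
  simp only [ancestorPath, Finset.mem_image, Finset.mem_range] at hz
  obtain ⟨j, hj, rfl⟩ := hz
  exact (hX.iterate hu j (by omega)).1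

theorem ParentClosed.exists_le_of_mem_ancestorPath [DecidableEq V]
    (hX : ParentClosed par dp root X) {u : V} (hu : u ∈ X) {n k : ℕ} (hn : n ≤ k + 1)
    (hk : k ≤ dp u) : ∀ z ∈ ancestorPath par u n, ∃ j ≤ dp z, par^[j] z = par^[k] u := by
  intro z hz
  simp only [ancestorPath, Finset.mem_image, Finset.mem_range] at hz
  obtain ⟨j, hj, rfl⟩ := hz
  have := (hX.iterate hu j (by omega)).2
  refine ⟨k - j, by omega, ?_⟩
  rw [← Function.iterate_add_apply]
  congr 1
  omega

/-- Either a small ball can be used to remove as much as a large one always does, or a large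
ball removes twice as much as a small one always does. -/
theorem ParentClosed.prunes_or_prunes (hX : ParentClosed par dp root X) {r s : ℕ} (hrs : r ≤ s) :
    Prunes par dp root X r (s + 1) ∨ Prunes par dp root X s (2 * r + 2) := by
  classical
  have hempty : ParentClosed par dp root (∅ : Finset V) := fun x hx => by simp at hx
  by_cases hsmall : ∀ x ∈ X, dp x ≤ s
  · exact Or.inr ⟨root, ∅, hempty, fun x hx _ => hX.near_root hx (hsmall x hx), Or.inl rfl⟩
  push Not at hsmall
  obtain ⟨x₀, hx₀, hsx₀⟩ := hsmall
  obtain ⟨u, hu, hmax⟩ := X.exists_max_image dp ⟨x₀, hx₀⟩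
  have hsu : s < dp u := hsx₀.trans_le (hmax _ hx₀)
  have hru : r ≤ dp u := hrs.trans hsu.le
  set y := par^[s] u with hy
  have hyd := (hX.iterate hu s hsu.le).2
  rw [← hy] at hyd
  have hdesc : ∀ x ∈ X, x ∉ _root_.nonDescendants par dp X y →
      ∃ j ≤ dp x, j ≤ s ∧ par^[j] x = y := by
    intro x hx hxY
    simp only [_root_.nonDescendants, Finset.mem_filter, not_and, not_forall, not_not] at hxY
    obtain ⟨j, hj, hjy⟩ := hxY hx
    have := (hX.iterate hx j hj).2
    rw [hjy] at this
    have := hmax x hx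
    exact ⟨j, hj, by omega, hjy⟩
  by_cases hcov : ∀ x ∈ X, x ∉ _root_.nonDescendants par dp X y → Near par (par^[r] u) x r
  · refine Or.inl ⟨par^[r] u, _, hX.nonDescendants y, hcov, Or.inr ?_⟩
    have := card_nonDescendants_add_le (X := X) y (ancestorPath par u (s + 1))
      (hX.ancestorPath_subset hu (by omega))
      (hX.exists_le_of_mem_ancestorPath hu le_rfl hsu.le)
    rwa [hX.card_ancestorPath hu (by omega)] at this
  · push Not at hcov
    obtain ⟨x, hx, hxY, hfar⟩ := hcov
    refine Or.inr ⟨y, _, hX.nonDescendants y, fun z hz hzY => ?_, Or.inr ?_⟩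
    · obtain ⟨j, -, hj, h⟩ := hdesc z hz hzY
      exact ⟨j, 0, by simpa using h, by omega⟩
    obtain ⟨i, hi, his, hiy⟩ := hdesc x hx hxY
    have hex : ∃ t, par^[t] x ∈ ancestorPath par u (s + 1) := by
      refine ⟨i, ?_⟩
      rw [hiy]
      exact Finset.mem_image.2 ⟨s, by simp, rfl⟩
    set t := Nat.find hex with ht
    have hti : t ≤ i := Nat.find_min' hex (by
      rw [hiy]
      exact Finset.mem_image.2 ⟨s, by simp, rfl⟩)
    have hmem := Nat.find_spec hex
    rw [← ht] at hmem
    simp only [ancestorPath, Finset.mem_image, Finset.mem_range] at hmem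
    obtain ⟨j, hj, hjt⟩ := hmem
    have hxt := (hX.iterate hx t (by omega)).2
    have huj := (hX.iterate hu j (by omega)).2
    have hxu := hmax x hx
    rw [← hjt] at hxt
    have hlarge : 2 * r + 1 ≤ t + j := by
      by_contra hlt
      apply hfar
      rcases le_total r j with h | h
      · refine ⟨t, j - r, ?_, by omega⟩
        rw [← hjt, ← Function.iterate_add_apply]
        congr 1
        omega
      · refine ⟨r - j + t, 0, ?_, by omega⟩
        rw [Function.iterate_add_apply, ← hjt, ← Function.iterate_add_apply]
        simp only [Function.iterate_zero, id]
        congr 1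
        omega
    have hdisj : Disjoint (ancestorPath par x t) (ancestorPath par u (s + 1)) := by
      rw [Finset.disjoint_left]
      intro z hz hz'
      obtain ⟨k, hk, rfl⟩ := Finset.mem_image.1 hz
      exact Nat.find_min hex (Finset.mem_range.1 hk) hz'
    have := card_nonDescendants_add_le (X := X) (dp := dp) (par := par) y
      (ancestorPath par x t ∪ ancestorPath par u (s + 1))
      (Finset.union_subset (hX.ancestorPath_subset hx (by omega))
        (hX.ancestorPath_subset hu (by omega))) (by
          intro z hz
          rcases Finset.mem_union.1 hz with h | h
          · rw [← hiy]
            exact hX.exists_le_of_mem_ancestorPath hx (by omega) hi z h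
          · exact hX.exists_le_of_mem_ancestorPath hu le_rfl hsu.le z h)
    rw [Finset.card_union_of_disjoint hdisj, hX.card_ancestorPath hu (by omega),
      hX.card_ancestorPath hx (by omega)] at this
    omega

theorem ParentClosed.prunes (hX : ParentClosed par dp root X) (r : ℕ) :
    Prunes par dp root X r (r + 1) := by
  rcases hX.prunes_or_prunes (le_refl r) with h | ⟨c, Y, h1, h2, h3⟩
  · exact h
  · exact ⟨c, Y, h1, h2, h3.imp_right fun h => by omega⟩

theorem Coverable.mono {A B : Set ℕ} (h : Coverable par X A) (hAB : A ⊆ B) :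
    Coverable par X B := by
  obtain ⟨c, hc⟩ := h
  refine ⟨c, fun x hx => ?_⟩
  obtain ⟨i, hi, h⟩ := hc x hx
  exact ⟨i, hAB hi, h⟩

theorem Prunes.coverable [Nonempty V] {i g : ℕ} {A B : Set ℕ}
    (h : Prunes par dp root X (i / 3) g)
    (hB : ∀ Y : Finset V, ParentClosed par dp root Y → Y.card + g ≤ X.card → Coverable par Y B)
    (hiA : i ∈ A) (hiB : i ∉ B) (hBA : B ⊆ A) : Coverable par X A := by
  classical
  obtain ⟨v, Y, hY, hnear, hcard⟩ := h
  have hYB : Coverable par Y B := by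
    rcases hcard with rfl | hcard
    · exact ⟨fun _ => Classical.arbitrary V, fun x hx => by simp at hx⟩
    · exact hB Y hY hcard
  obtain ⟨c, hc⟩ := hYB
  refine ⟨Function.update c i v, fun x hx => ?_⟩
  by_cases hxY : x ∈ Y
  · obtain ⟨j, hj, h⟩ := hc x hxY
    refine ⟨j, hBA hj, ?_⟩
    rwa [Function.update_of_ne (by rintro rfl; exact hiB hj)]
  · exact ⟨i, hiA, by simpa using hnear x hx hxY⟩

/-- The indices below `q`, together with those in `[m, p)`. -/
def indexSet (m p q : ℕ) : Set ℕ := {i | i < q ∨ (m ≤ i ∧ i < p)}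

theorem coverable_indexSet_of_trivial_bound [Nonempty V] {m q : ℕ} {F : ℚ} (hqm : q ≤ m)
    (hF : ∀ Y : Finset V, ParentClosed par dp root Y → 3 * (Y.card : ℚ) ≤ F →
      Coverable par Y (Set.Iio q)) (p : ℕ) (hmp : m ≤ p) (hX : ParentClosed par dp root X)
    (hcard : 3 * (X.card : ℚ) ≤ F + ((p : ℚ) ^ 2 - (m : ℚ) ^ 2) / 2) :
    Coverable par X (indexSet m p q) := by
  induction p, hmp using Nat.le_induction generalizing X with
  | base =>
    refine (hF X hX (by linarith)).mono fun i hi => Or.inl hi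
  | succ p hmp ih =>
    refine (hX.prunes (p / 3)).coverable (B := indexSet m p q) (fun Y hY hYX => ih hY ?_)
      (Or.inr (by omega)) (by simp only [indexSet, Set.mem_ofPred_eq]; omega)
      (by intro i; simp only [indexSet, Set.mem_ofPred_eq]; omega)
    have h : 3 * Y.card + p + 1 ≤ 3 * X.card := by omega
    have h' : 3 * (Y.card : ℚ) + p + 1 ≤ 3 * X.card := by exact_mod_cast h
    push_cast at hcard
    nlinarith

theorem coverable_indexSet [Nonempty V] {K m : ℕ} {C : ℚ} {X : Finset V} (hm : m < K)
    (hF : ∀ q < K, ∀ Y : Finset V, ParentClosed par dp root Y →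
      3 * (Y.card : ℚ) ≤ 8 / 13 * (q : ℚ) ^ 2 - C → Coverable par Y (Set.Iio q))
    (p q : ℕ) (hqm : q ≤ m) (hmp : m ≤ p) (hpK : p ≤ K) (hX : ParentClosed par dp root X)
    (hcard : 3 * (X.card : ℚ) ≤ p * q + ((p : ℚ) ^ 2 - (m : ℚ) ^ 2) / 2 - (p - m) * K / 2
      - 13 / 32 * (m : ℚ) ^ 2 - C) :
    Coverable par X (indexSet m p q) := by
  have hmp' : (m : ℚ) ≤ p := by exact_mod_cast hmp
  have hpK' : (p : ℚ) ≤ K := by exact_mod_cast hpK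
  by_cases hq : 2 * q ≤ K
  · refine coverable_indexSet_of_trivial_bound hqm (hF q (by omega)) p hmp hX ?_
    have hq' : 2 * (q : ℚ) ≤ K := by exact_mod_cast hq
    nlinarith [sq_nonneg ((q : ℚ) - 13 / 16 * m),
      mul_nonneg (sub_nonneg.2 hmp') (sub_nonneg.2 hq')]
  rcases hmp.eq_or_lt with rfl | hlt
  · refine (hF q (by omega) X hX ?_).mono fun i hi => Or.inl hi
    nlinarith [sq_nonneg ((q : ℚ) - 13 / 16 * m)]
  obtain ⟨q, rfl⟩ : ∃ a, q = a + 1 := ⟨q - 1, by omega⟩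
  obtain ⟨p, rfl⟩ : ∃ a, p = a + 1 := ⟨p - 1, by omega⟩
  have hq' : (K : ℚ) + 1 ≤ 2 * (q + 1) := by exact_mod_cast (by omega : K + 1 ≤ 2 * (q + 1))
  push_cast at hcard hpK' hmp'
  rcases hX.prunes_or_prunes (r := q / 3) (s := p / 3) (by omega) with h | h
  · refine h.coverable (B := indexSet m (p + 1) q) (fun Y hY hYX =>
      coverable_indexSet hm hF (p + 1) q (by omega) hmp hpK hY ?_)
      (Or.inl (by omega)) (by simp only [indexSet, Set.mem_ofPred_eq]; omega)
      (by intro i; simp only [indexSet, Set.mem_ofPred_eq]; omega)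
    have h : 3 * Y.card + p + 1 ≤ 3 * X.card := by omega
    have h' : 3 * (Y.card : ℚ) + p + 1 ≤ 3 * X.card := by exact_mod_cast h
    push_cast
    linarith
  · refine h.coverable (B := indexSet m p (q + 1)) (fun Y hY hYX =>
      coverable_indexSet hm hF p (q + 1) hqm (by omega) (by omega) hY ?_)
      (Or.inr (by omega)) (by simp only [indexSet, Set.mem_ofPred_eq]; omega)
      (by intro i; simp only [indexSet, Set.mem_ofPred_eq]; omega)
    have h : 3 * Y.card + 2 * q + 2 ≤ 3 * X.card := by omega
    have h' : 3 * (Y.card : ℚ) + 2 * q + 2 ≤ 3 * X.card := by exact_mod_cast h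
    push_cast
    linarith
termination_by p + q

theorem coverable_Iio [Nonempty V] (K : ℕ) (hX : ParentClosed par dp root X)
    (hcard : 3 * (X.card : ℚ) ≤ 8 / 13 * (K : ℚ) ^ 2 - 8 / 13 * 1000 ^ 2) :
    Coverable par X (Set.Iio K) := by
  induction K using Nat.strong_induction_on generalizing X with
  | _ K ih =>
    rcases le_or_gt K 1000 with hK | hK
    · have hK' : (K : ℚ) ≤ 1000 := by exact_mod_cast hK
      have h : (X.card : ℚ) ≤ 0 := by nlinarith
      have h0 : X = ∅ := Finset.card_eq_zero.1 (by exact_mod_cast h.antisymm (by positivity))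
      exact ⟨fun _ => Classical.arbitrary V, fun x hx => by simp [h0] at hx⟩
    · refine (coverable_indexSet (K := K) (m := 4 * K / 5) (by omega)
        (fun q hq Y hY h => ih q hq hY h) K (4 * K / 5) le_rfl (by omega) le_rfl hX ?_).mono ?_
      · obtain ⟨m, hm⟩ : ∃ m, m = 4 * K / 5 := ⟨_, rfl⟩
        rw [← hm]
        have h1 : 5 * (m : ℚ) ≤ 4 * K := by exact_mod_cast (by omega : 5 * m ≤ 4 * K)
        have h2 : 4 * (K : ℚ) ≤ 5 * m + 4 := by exact_mod_cast (by omega : 4 * K ≤ 5 * m + 4)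
        have hK' : (1000 : ℚ) < K := by exact_mod_cast hK
        nlinarith
      · intro i
        simp only [indexSet, Set.mem_ofPred_eq, Set.mem_Iio]
        omega

end Forest

section Graph

variable {V : Type*} {G : SimpleGraph V}

theorem SimpleGraph.Connected.dist_iterate_le (hG : G.Connected) {par : V → V} {d : ℕ}
    (hpar : ∀ v, G.dist v (par v) ≤ d) (v : V) (i : ℕ) : G.dist v (par^[i] v) ≤ d * i := by
  induction i with
  | zero => simp
  | succ i ih =>
    rw [Function.iterate_succ_apply']
    have h1 := hG.dist_triangle (u := v) (v := par^[i] v) (w := par (par^[i] v))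
    have h2 := hpar (par^[i] v)
    rw [Nat.mul_succ]
    omega

theorem SimpleGraph.Connected.dist_le_of_near (hG : G.Connected) {par : V → V} {d : ℕ}
    (hpar : ∀ v, G.dist v (par v) ≤ d) {c x : V} {r : ℕ} (h : Near par c x r) :
    G.dist c x ≤ d * r := by
  obtain ⟨i, j, hij, hr⟩ := h
  have h1 := hG.dist_iterate_le hpar x i
  have h2 := hG.dist_iterate_le hpar c j
  have h3 := hG.dist_triangle (u := c) (v := par^[j] c) (w := x)
  rw [dist_comm (u := par^[j] c), ← hij] at h3
  rw [← hij] at h2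
  have := Nat.mul_le_mul_left d hr
  rw [Nat.mul_add] at this
  omega

/-- A maximal set of vertices at pairwise distance at least three in a connected graph can be
chosen to be spanned by a rooted tree whose edges join vertices at distance at most three. -/
theorem SimpleGraph.Connected.exists_tree_of_dist_three [Fintype V] (hG : G.Connected) :
    ∃ (par : V → V) (dp : V → ℕ) (root : V) (S : Finset V), ParentClosed par dp root S ∧
      (∀ v, G.dist v (par v) ≤ 3) ∧ (∀ s ∈ S, ∀ t ∈ S, s ≠ t → 3 ≤ G.dist s t) ∧
      ∀ v, ∃ s ∈ S, G.dist s v ≤ 2 := by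
  classical
  obtain ⟨root⟩ := hG.nonempty
  let P : Finset V → Prop := fun S => root ∈ S ∧
    (∀ s ∈ S, ∀ t ∈ S, s ≠ t → 3 ≤ G.dist s t) ∧
    ∃ (par : V → V) (dp : V → ℕ), ParentClosed par dp root S ∧ ∀ v, G.dist v (par v) ≤ 3
  have hP : P {root} := by
    refine ⟨by simp, by simp, id, fun _ => 0, ?_, by simp⟩
    intro x hx
    exact Or.inl ⟨rfl, by simpa using hx⟩
  obtain ⟨S, hS, hmax⟩ := (Finset.univ.filter P).exists_max_image Finset.card
    ⟨{root}, by simpa using hP⟩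
  obtain ⟨hroot, hsep, par, dp, hclosed, hpar⟩ := (Finset.mem_filter.1 hS).2
  refine ⟨par, dp, root, S, hclosed, hpar, hsep, ?_⟩
  by_contra hfar
  push Not at hfar
  obtain ⟨v₀, hv₀⟩ := hfar
  obtain ⟨v, hv, hmin⟩ := (Finset.univ.filter fun v => ∀ s ∈ S, 2 < G.dist s v).exists_min_image
    (fun v => G.dist root v) ⟨v₀, by simpa using hv₀⟩
  have hv : ∀ s ∈ S, 2 < G.dist s v := (Finset.mem_filter.1 hv).2
  have hvS : v ∉ S := fun h => by simpa using hv v h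
  obtain ⟨w, hwv, hw⟩ : ∃ w, G.Adj w v ∧ G.dist root w < G.dist root v := by
    obtain ⟨W, hW⟩ := hG.exists_walk_length_eq_dist v root
    cases W with
    | nil => exact absurd hroot hvS
    | cons hadj W =>
      refine ⟨_, hadj.symm, ?_⟩
      have := dist_le W
      rw [Walk.length_cons] at hW
      rw [dist_comm, dist_comm (u := root)]
      omega
  obtain ⟨s, hs, hsw⟩ : ∃ s ∈ S, G.dist s w ≤ 2 := by
    by_contra hcon
    push Not at hcon
    exact absurd (hmin w (by simpa using hcon)) (by omega)
  have hsv : G.dist s v ≤ 3 := by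
    have := hG.dist_triangle (u := s) (v := w) (w := v)
    have := dist_eq_one_iff_adj.2 hwv
    omega
  have hne : ∀ x ∈ S, x ≠ v := fun x hx h => hvS (h ▸ hx)
  have hins : P (insert v S) := by
    refine ⟨Finset.mem_insert_of_mem hroot, ?_, Function.update par v s,
      Function.update dp v (dp s + 1), ?_, ?_⟩
    · intro a ha b hb hab
      rcases Finset.mem_insert.1 ha with rfl | ha' <;>
        rcases Finset.mem_insert.1 hb with rfl | hb'
      · exact absurd rfl hab
      · rw [dist_comm]
        exact hv b hb'
      · exact hv a ha'
      · exact hsep a ha' b hb' hab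
    · intro x hx
      rcases Finset.mem_insert.1 hx with rfl | hx
      · refine Or.inr ?_
        rw [Function.update_self, Function.update_self, Function.update_of_ne (hne s hs)]
        exact ⟨Finset.mem_insert_of_mem hs, rfl⟩
      · rw [Function.update_of_ne (hne x hx), Function.update_of_ne (hne x hx)]
        refine (hclosed x hx).imp_right fun h => ?_
        rw [Function.update_of_ne (hne _ h.1)]
        exact ⟨Finset.mem_insert_of_mem h.1, h.2⟩
    · intro x
      by_cases hx : x = v
      · subst hx
        rw [Function.update_self, dist_comm]
        exact hsv
      · rw [Function.update_of_ne hx]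
        exact hpar x
  have := hmax _ (Finset.mem_filter.2 ⟨Finset.mem_univ _, hins⟩)
  rw [Finset.card_insert_of_notMem hvS] at this
  omega

theorem SimpleGraph.card_mul_succ_le_of_dist_three [Fintype V] [DecidableRel G.Adj]
    (hG : G.Connected) {d : ℕ} (hd : ∀ v, d ≤ G.degree v) {S : Finset V}
    (hS : ∀ s ∈ S, ∀ t ∈ S, s ≠ t → 3 ≤ G.dist s t) :
    S.card * (d + 1) ≤ Fintype.card V := by
  classical
  have hle : ∀ s x, x ∈ insert s (G.neighborFinset s) → G.dist s x ≤ 1 := by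
    intro s x hx
    rcases Finset.mem_insert.1 hx with rfl | hx
    · simp
    · exact (dist_eq_one_iff_adj.2 ((G.mem_neighborFinset s x).1 hx)).le
  have hdisj : (S : Set V).PairwiseDisjoint fun s => insert s (G.neighborFinset s) := by
    intro s hs t ht hst
    refine Finset.disjoint_left.2 fun x hxs hxt => ?_
    have h1 := hle s x hxs
    have h2 := hle t x hxt
    have h3 := hG.dist_triangle (u := s) (v := x) (w := t)
    have h4 := hS s hs t ht hst
    rw [dist_comm (u := x)] at h3
    omega
  calc S.card * (d + 1) ≤ ∑ s ∈ S, (insert s (G.neighborFinset s)).card := by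
        rw [← smul_eq_mul]
        refine Finset.card_nsmul_le_sum _ _ _ fun s _ => ?_
        rw [Finset.card_insert_of_notMem (by simp), G.card_neighborFinset_eq_degree]
        exact Nat.succ_le_succ (hd s)
    _ = (S.biUnion fun s => insert s (G.neighborFinset s)).card :=
        (Finset.card_biUnion hdisj).symm
    _ ≤ Fintype.card V := Finset.card_le_univ _

end Graph

theorem burning_of_min_degree_four :
    ∃ N : ℕ, ∀ (V : Type) [Fintype V] (G : SimpleGraph V) [DecidableRel G.Adj],
      G.Connected → (∀ v : V, 4 ≤ G.degree v) → N ≤ Fintype.card V →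
      burningNumber G ≤ ⌈Real.sqrt (Fintype.card V)⌉₊ := by
  refine ⟨10000 ^ 2, fun V _ G _ hG hdeg hN => Nat.sInf_le ?_⟩
  obtain ⟨k, hk⟩ : ∃ k, k = ⌈Real.sqrt (Fintype.card V)⌉₊ := ⟨_, rfl⟩
  rw [← hk]
  have hkV : Fintype.card V ≤ k ^ 2 := by
    have h := Nat.le_ceil (Real.sqrt (Fintype.card V))
    rw [← hk, Real.sqrt_le_left (by positivity)] at h
    exact_mod_cast h
  have hk_large : 10000 ≤ k := (Nat.pow_le_pow_iff_left two_ne_zero).1 (hN.trans hkV)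
  obtain ⟨par, dp, root, S, hclosed, hpar, hsep, hdom⟩ := hG.exists_tree_of_dist_three
  have hS := card_mul_succ_le_of_dist_three hG hdeg hsep
  have : Nonempty V := ⟨root⟩
  obtain ⟨K, rfl⟩ : ∃ K, k = K + 2 := ⟨k - 2, by omega⟩
  obtain ⟨c, hc⟩ := coverable_Iio K hclosed (by
    have h1 : (S.card : ℚ) * 5 ≤ (K + 2) ^ 2 := by exact_mod_cast hS.trans hkV
    have h2 : (9998 : ℚ) ≤ K := by exact_mod_cast (by omega : 9998 ≤ K)
    nlinarith only [h1, h2, mul_self_nonneg ((K : ℚ) - 9998)])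
  refine ⟨fun i => c (K - 1 - i), fun u => ?_⟩
  obtain ⟨s, hs, hsu⟩ := hdom u
  obtain ⟨i, hi, hnear⟩ := hc s hs
  have hi : i < K := hi
  refine ⟨⟨K - 1 - i, by omega⟩, hG _ _, ?_⟩
  have h1 := hG.dist_le_of_near hpar hnear
  have h2 := hG.dist_triangle (u := c i) (v := s) (w := u)
  have h3 : K - 1 - (K - 1 - i) = i := by omega
  simp only [h3]
  omega
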